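/- arXiv:1504.00148 — 2 statements merged into one kernel-verified Lean document; each statement's English description precedes it below -/
import Mathlib

section
/- Let p ≥ 3 be a prime and r ≥ 2p+1 an integer. Write r = p^n·u with p ∤ u, set δ = 0 if r = u and δ = 1 otherwise, and let Σ = Σ_p(u−1) be the sum of the base-p digits of u−1. Then the F_p-dimension of X_{r−1} equals 2Σ + 2 + δ(p + 1 − Σ) if Σ ≤ p−1, and equals 2p + 2 if Σ > p−1. -/
open MvPolynomial

/-- The action of a 2×2 matrix `g` over `F_p` on polynomials in two variables:
`((a b; c d) · F)(X, Y) = F (aX + cY, bX + dY)`. -/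
noncomputable def matAct (p : ℕ) (g : Matrix (Fin 2) (Fin 2) (ZMod p)) :
    MvPolynomial (Fin 2) (ZMod p) →ₐ[ZMod p] MvPolynomial (Fin 2) (ZMod p) :=
  aeval fun i => ∑ j, C (g j i) * X j

/-- The action of `g` twisted by the `n`-th power of the determinant character `D`. -/
noncomputable def twAct (p n : ℕ) (g : Matrix (Fin 2) (Fin 2) (ZMod p))
    (F : MvPolynomial (Fin 2) (ZMod p)) : MvPolynomial (Fin 2) (ZMod p) :=
  g.det ^ n • matAct p g F

/-- `V_m`: homogeneous polynomials of degree `m` in two variables over `F_p`. -/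
noncomputable def Vh (p m : ℕ) : Submodule (ZMod p) (MvPolynomial (Fin 2) (ZMod p)) :=
  homogeneousSubmodule (Fin 2) (ZMod p) m

/-- `X_r`: the `M`-submodule of `V_r` generated by `X^r`, realized as the span of the
orbit of `X^r` under the monoid `M = M_2(F_p)`. -/
noncomputable def XrSub (p r : ℕ) : Submodule (ZMod p) (MvPolynomial (Fin 2) (ZMod p)) :=
  Submodule.span (ZMod p)
    (Set.range fun g : Matrix (Fin 2) (Fin 2) (ZMod p) => matAct p g (X 0 ^ r))

/-- `X_{r-1}`: the `M`-submodule of `V_r` generated by `X^{r-1} Y`. -/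
noncomputable def Xr1Sub (p r : ℕ) : Submodule (ZMod p) (MvPolynomial (Fin 2) (ZMod p)) :=
  Submodule.span (ZMod p)
    (Set.range fun g : Matrix (Fin 2) (Fin 2) (ZMod p) => matAct p g (X 0 ^ (r - 1) * X 1))

/-- The special polynomial `θ = X^p Y − X Y^p`. -/
noncomputable def theta (p : ℕ) : MvPolynomial (Fin 2) (ZMod p) :=
  X 0 ^ p * X 1 - X 0 * X 1 ^ p

/-- `V_r^* = {F ∈ V_r : θ ∣ F}`. -/
noncomputable def Vstar (p r : ℕ) : Submodule (ZMod p) (MvPolynomial (Fin 2) (ZMod p)) :=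
  Vh p r ⊓ (Ideal.span {theta p}).restrictScalars (ZMod p)

/-- `V_r^{**} = {F ∈ V_r : θ² ∣ F}`. -/
noncomputable def Vdstar (p r : ℕ) : Submodule (ZMod p) (MvPolynomial (Fin 2) (ZMod p)) :=
  Vh p r ⊓ (Ideal.span {theta p ^ 2}).restrictScalars (ZMod p)

/-- `M`-equivariance of a linear map between two submodules of the polynomial ring,
where the source carries the action twisted by `D^{nA}` and the target by `D^{nB}`. -/
def EquivMap (p nA nB : ℕ)
    {A B : Submodule (ZMod p) (MvPolynomial (Fin 2) (ZMod p))}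
    (φ : A →ₗ[ZMod p] B) : Prop :=
  ∀ (g : Matrix (Fin 2) (Fin 2) (ZMod p)) (x y : A),
    (y : MvPolynomial (Fin 2) (ZMod p)) = twAct p nA g (x : MvPolynomial (Fin 2) (ZMod p)) →
    (φ y : MvPolynomial (Fin 2) (ZMod p)) = twAct p nB g (φ x : MvPolynomial (Fin 2) (ZMod p))


theorem not_dvd_choose_iff_lucas {p : ℕ} [Fact p.Prime] (m j : ℕ) :
    ¬ p ∣ m.choose j ↔ j % p ≤ m % p ∧ ¬ p ∣ (m / p).choose (j / p) := by
  have hp : p.Prime := Fact.out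
  have h := (Choose.choose_modEq_choose_mod_mul_choose_div_nat (p := p) (n := m) (k := j)).dvd_iff
    (dvd_refl p)
  rw [h, hp.dvd_mul, not_or]
  refine and_congr_left fun _ => ⟨fun h1 => ?_, fun h1 h2 => ?_⟩
  · by_contra! h2
    exact h1 (by rw [Nat.choose_eq_zero_of_lt h2]; exact dvd_zero p)
  · have h3 : p ∣ (m % p).factorial := by
      rw [← Nat.choose_mul_factorial_mul_factorial h1, mul_assoc]
      exact dvd_mul_of_dvd_left h2 _
    exact absurd ((hp.dvd_factorial).1 h3) (not_le.2 (Nat.mod_lt _ hp.pos))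

theorem digits_sum_eq_mod_add {p : ℕ} (hp : 1 < p) (m : ℕ) :
    (p.digits m).sum = m % p + (p.digits (m / p)).sum := by
  rcases Nat.eq_zero_or_pos m with rfl | hm
  · simp
  · rw [Nat.digits_def' hp hm, List.sum_cons]

theorem digits_sum_add_mul {p : ℕ} (hp : 1 < p) {d : ℕ} (hd : d < p) (m : ℕ) :
    (p.digits (d + p * m)).sum = d + (p.digits m).sum := by
  rw [digits_sum_eq_mod_add hp, Nat.add_mul_mod_self_left, Nat.mod_eq_of_lt hd,
    Nat.add_mul_div_left _ _ (by omega), Nat.div_eq_of_lt hd, zero_add]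

theorem digits_sum_eq_zero_iff {p : ℕ} (hp : 1 < p) {m : ℕ} :
    (p.digits m).sum = 0 ↔ m = 0 := by
  refine ⟨fun h => ?_, fun h => by simp [h]⟩
  induction m using Nat.strong_induction_on with
  | _ m ih =>
    by_contra hm
    rw [digits_sum_eq_mod_add hp] at h
    have := ih (m / p) (Nat.div_lt_self (by omega) hp) (by omega)
    have h2 := Nat.mod_add_div m p
    rw [this] at h2
    omega

theorem digits_sum_pow_mul {p : ℕ} (hp : 1 < p) (n m : ℕ) :
    (p.digits (p ^ n * m)).sum = (p.digits m).sum := by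
  induction n with
  | zero => simp
  | succ n ih =>
    have := digits_sum_add_mul hp (d := 0) (by omega) (p ^ n * m)
    rw [← ih, pow_succ', mul_assoc]
    simpa using this

/-- Every value up to the digit sum of `m` is the digit sum of some `j` whose digits are
dominated by those of `m`. -/
theorem exists_digits_sum_eq {p : ℕ} [Fact p.Prime] (m s : ℕ) (hs : s ≤ (p.digits m).sum) :
    ∃ j ≤ m, ¬ p ∣ m.choose j ∧ (p.digits j).sum = s := by
  have hp : p.Prime := Fact.out
  induction m using Nat.strong_induction_on generalizing s with
  | _ m ih =>
    rcases Nat.eq_zero_or_pos m with rfl | hm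
    · exact ⟨0, le_rfl, by simpa using hp.one_lt.ne', by simp at hs; simp [hs]⟩
    have hlt := Nat.mod_lt m hp.pos
    rw [digits_sum_eq_mod_add hp.one_lt] at hs
    have key : ∀ d ≤ m % p, ∀ t ≤ (p.digits (m / p)).sum, d + t = s →
        ∃ j ≤ m, ¬ p ∣ m.choose j ∧ (p.digits j).sum = s := by
      intro d hd t ht hdt
      obtain ⟨j, hj, h1, h2⟩ := ih (m / p) (Nat.div_lt_self hm hp.one_lt) t ht
      refine ⟨d + p * j, ?_, ?_, ?_⟩
      · have := Nat.mod_add_div m p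
        have := Nat.mul_le_mul_left p hj
        omega
      · rw [not_dvd_choose_iff_lucas, Nat.add_mul_mod_self_left, Nat.mod_eq_of_lt (show d < p by omega),
          Nat.add_mul_div_left _ _ hp.pos, Nat.div_eq_of_lt (show d < p by omega), zero_add]
        exact ⟨hd, h1⟩
      · rw [digits_sum_add_mul hp.one_lt (by omega), h2, hdt]
    rcases le_total s (m % p) with h | h
    · exact key s h 0 (Nat.zero_le _) rfl
    · exact key (m % p) le_rfl (s - m % p) (by omega) (by omega)

/-- Kummer's theorem in the case of no carries. -/
theorem digits_sum_add_of_not_dvd_choose {p : ℕ} [Fact p.Prime] {m j : ℕ}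
    (h : ¬ p ∣ m.choose j) :
    (p.digits j).sum + (p.digits (m - j)).sum = (p.digits m).sum := by
  have hp : p.Prime := Fact.out
  induction m using Nat.strong_induction_on generalizing j with
  | _ m ih =>
    rcases Nat.eq_zero_or_pos m with rfl | hm
    · rcases Nat.eq_zero_or_pos j with rfl | hj
      · simp
      · exact absurd (by rw [Nat.choose_eq_zero_of_lt hj]; exact dvd_zero p) h
    obtain ⟨h1, h2⟩ := (not_dvd_choose_iff_lucas m j).1 h
    have h3 := ih (m / p) (Nat.div_lt_self hm hp.one_lt) h2
    have hle : j / p ≤ m / p := by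
      by_contra! hc
      exact h2 (by rw [Nat.choose_eq_zero_of_lt hc]; exact dvd_zero p)
    have hsub : m - j = (m % p - j % p) + p * (m / p - j / p) := by
      have ha := Nat.mod_add_div m p
      have hb := Nat.mod_add_div j p
      have hc := Nat.mul_le_mul_left p hle
      rw [Nat.mul_sub]
      omega
    have hlt := Nat.mod_lt m hp.pos
    rw [hsub, digits_sum_add_mul hp.one_lt (by omega), digits_sum_eq_mod_add hp.one_lt j,
      digits_sum_eq_mod_add hp.one_lt m]
    omega

theorem natCast_digits_sum {p : ℕ} (hp : 3 ≤ p) (j : ℕ) :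
    (((p.digits j).sum : ℕ) : ZMod (p - 1)) = (j : ZMod (p - 1)) := by
  refine ((ZMod.natCast_eq_natCast_iff _ _ _).2 (Nat.modEq_digits_sum (p - 1) p ?_ j)).symm
  obtain ⟨q, rfl⟩ : ∃ q, p = q + 1 := ⟨p - 1, by omega⟩
  rw [Nat.add_sub_cancel, Nat.add_mod_left, Nat.mod_eq_of_lt (by omega)]

/-- The coefficient of `X^(r-j) Y^j` in `X (X + Y)^(r-1)`. -/
def coeffX (p r j : ℕ) : ZMod p := ((r - 1).choose j : ZMod p)

/-- The coefficient of `X^(r-j) Y^j` in `Y (X + Y)^(r-1)`. -/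
def coeffY (p r j : ℕ) : ZMod p := if j = 0 then 0 else ((r - 1).choose (j - 1) : ZMod p)

/-- The form of degree `r` with coefficients `v`. -/
noncomputable def formOf (p r : ℕ) : (ℕ → ZMod p) →ₗ[ZMod p] MvPolynomial (Fin 2) (ZMod p) :=
  ∑ j ∈ Finset.range (r + 1),
    (LinearMap.proj j).smulRight (X 0 ^ (r - j) * X 1 ^ j : MvPolynomial (Fin 2) (ZMod p))

theorem formOf_apply (p r : ℕ) (v : ℕ → ZMod p) :
    formOf p r v = ∑ j ∈ Finset.range (r + 1), v j • (X 0 ^ (r - j) * X 1 ^ j) := by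
  simp [formOf]

theorem formOf_congr {p r : ℕ} {v w : ℕ → ZMod p} (h : ∀ j ≤ r, v j = w j) :
    formOf p r v = formOf p r w := by
  rw [formOf_apply, formOf_apply]
  exact Finset.sum_congr rfl fun j hj => by rw [h j (by simpa [Nat.lt_succ_iff] using hj)]

theorem formOf_eq_zero_iff {p r : ℕ} {v : ℕ → ZMod p} :
    formOf p r v = 0 ↔ ∀ j ≤ r, v j = 0 := by
  refine ⟨fun h i hi => ?_, fun h => by rw [formOf_congr h]; simp [formOf_apply]⟩
  have hc := congrArg (coeff (Finsupp.single 0 (r - i) + Finsupp.single 1 i)) h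
  rw [formOf_apply, coeff_sum, coeff_zero, Finset.sum_eq_single i] at hc
  · simpa [X_pow_eq_monomial, monomial_mul] using hc
  · intro j _ hji
    rw [coeff_smul, X_pow_eq_monomial, X_pow_eq_monomial, monomial_mul, coeff_monomial, if_neg,
      smul_zero]
    intro he
    have := DFunLike.congr_fun he 1
    simp at this
    exact hji this
  · intro hn
    exact absurd (Finset.mem_range.2 (by omega)) hn

theorem matAct_eq_formOf {p r : ℕ} (hr : 1 ≤ r) (g : Matrix (Fin 2) (Fin 2) (ZMod p)) :
    matAct p g (X 0 ^ (r - 1) * X 1) = formOf p r fun j =>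
      g 0 1 * (g 0 0 ^ (r - 1 - j) * g 1 0 ^ j * coeffX p r j) +
        g 1 1 * (g 0 0 ^ (r - j) * g 1 0 ^ (j - 1) * coeffY p r j) := by
  obtain ⟨m, rfl⟩ : ∃ m, r = m + 1 := ⟨r - 1, by omega⟩
  rw [formOf_apply]
  simp only [add_smul, Finset.sum_add_distrib, Nat.add_sub_cancel]
  rw [Finset.sum_range_succ, Finset.sum_range_succ' _ (m + 1)]
  have h1 : coeffX p (m + 1) (m + 1) = 0 := by simp [coeffX]
  have h2 : coeffY p (m + 1) 0 = 0 := by simp [coeffY]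
  simp only [h1, h2, mul_zero, zero_smul, add_zero]
  simp only [matAct, map_mul, map_pow, aeval_X, Fin.sum_univ_two]
  rw [mul_add, ← Finset.sum_add_distrib, add_comm (C (g 0 0) * X 0), add_pow, Finset.sum_mul,
    Finset.sum_mul, ← Finset.sum_add_distrib]
  refine Finset.sum_congr rfl fun j hj => ?_
  have hj : j ≤ m := by simpa [Nat.lt_succ_iff] using hj
  have h3 : m + 1 - j = m - j + 1 := by omega
  simp only [coeffX, coeffY, smul_eq_C_mul, Nat.add_sub_cancel, Nat.add_sub_add_right, h3,
    Nat.add_eq_zero_iff, one_ne_zero, and_false, if_false, map_mul, map_pow, map_natCast]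
  ring

/-- The coefficients of the general element of `X_{r-1}`: the first two and the last two are free,
the others are combinations of `coeffX` and `coeffY` depending on the class of `j` mod `p - 1`. -/
noncomputable def coeffMap (p r : ℕ) :
    ((Fin 4 → ZMod p) × (ZMod (p - 1) → ZMod p × ZMod p)) →ₗ[ZMod p] (ℕ → ZMod p) where
  toFun w j :=
    if j = 0 then w.1 0 else if j = 1 then w.1 1 else if j + 1 = r then w.1 2 else
      if j = r then w.1 3 else (w.2 j).1 * coeffX p r j + (w.2 j).2 * coeffY p r j
  map_add' w w' := by
    ext j
    simp only [Pi.add_apply, Prod.fst_add, Prod.snd_add]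
    split_ifs <;> first | rfl | ring
  map_smul' a w := by
    ext j
    simp only [Pi.smul_apply, Prod.smul_fst, Prod.smul_snd, smul_eq_mul, RingHom.id_apply]
    split_ifs <;> first | rfl | ring

theorem coeffMap_apply (p r : ℕ) (w : (Fin 4 → ZMod p) × (ZMod (p - 1) → ZMod p × ZMod p))
    (j : ℕ) : coeffMap p r w j =
      if j = 0 then w.1 0 else if j = 1 then w.1 1 else if j + 1 = r then w.1 2 else
      if j = r then w.1 3 else (w.2 j).1 * coeffX p r j + (w.2 j).2 * coeffY p r j := rfl

theorem eq_of_natCast_eq {n a b : ℕ} (ha : 1 ≤ a) (ha' : a ≤ n) (hb : 1 ≤ b) (hb' : b ≤ n)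
    (h : (a : ZMod n) = b) : a = b := by
  refine Nat.ModEq.eq_of_abs_lt ((ZMod.natCast_eq_natCast_iff _ _ _).1 h) ?_
  rw [abs_lt]
  omega

theorem pow_val_natCast {p : ℕ} [Fact p.Prime] {c : ZMod p} (hc : c ≠ 0) (j : ℕ) :
    c ^ (j : ZMod (p - 1)).val = c ^ j := by
  rw [ZMod.val_natCast]
  conv_rhs => rw [← Nat.mod_add_div j (p - 1), pow_add, pow_mul, ZMod.pow_card_sub_one_eq_one hc,
    one_pow, mul_one]

theorem Xr1Sub_le_range {p r : ℕ} [Fact p.Prime] (hr : 4 ≤ r) :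
    Xr1Sub p r ≤ LinearMap.range (formOf p r ∘ₗ coeffMap p r) := by
  rw [Xr1Sub, Submodule.span_le]
  rintro _ ⟨g, rfl⟩
  simp only [matAct_eq_formOf (show 1 ≤ r by omega)]
  set v : ℕ → ZMod p := fun j =>
      g 0 1 * (g 0 0 ^ (r - 1 - j) * g 1 0 ^ j * coeffX p r j) +
        g 1 1 * (g 0 0 ^ (r - j) * g 1 0 ^ (j - 1) * coeffY p r j) with hv
  refine ⟨(![v 0, v 1, v (r - 1), v r], fun t => if g 0 0 = 0 ∨ g 1 0 = 0 then 0 else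
    (g 0 1 * (g 0 0 ^ (r - 1) * (g 1 0 / g 0 0) ^ t.val),
      g 1 1 * (g 0 0 ^ r * ((g 1 0)⁻¹ * (g 1 0 / g 0 0) ^ t.val)))), ?_⟩
  refine formOf_congr fun j hj => ?_
  rw [coeffMap_apply]
  rcases eq_or_ne j 0 with rfl | h0
  · simp
  rcases eq_or_ne j 1 with rfl | h1
  · simp
  by_cases h2 : j + 1 = r
  · simp [h0, h1, ← h2]
  rcases eq_or_ne j r with rfl | h3
  · simp [h0, h1]
  simp only [if_neg h0, if_neg h1, if_neg h2, if_neg h3]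
  split_ifs with h4
  · simp only [hv, Prod.fst_zero, Prod.snd_zero, zero_mul, add_zero]
    have e1 : r - 1 - j ≠ 0 := by omega
    have e2 : r - j ≠ 0 := by omega
    have e3 : j - 1 ≠ 0 := by omega
    rcases h4 with h4 | h4 <;> simp [h4, e1, e2, e3, h0]
  · rw [not_or] at h4
    obtain ⟨ha, hc⟩ := h4
    rw [pow_val_natCast (div_ne_zero hc ha)]
    have e1 : g 0 0 ^ (r - 1) = g 0 0 ^ (r - 1 - j) * g 0 0 ^ j := by
      rw [← pow_add]; congr 1; omega
    have e2 : g 0 0 ^ r = g 0 0 ^ (r - j) * g 0 0 ^ j := by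
      rw [← pow_add]; congr 1; omega
    have e3 : g 1 0 ^ j = g 1 0 ^ (j - 1) * g 1 0 := by
      rw [← pow_succ]; congr 1; omega
    simp only [hv, e1, e2, div_pow, e3]
    field_simp

/-- Fourier inversion on the residues modulo `p - 1`. -/
theorem exists_sum_units_eq {p : ℕ} [Fact p.Prime] [NeZero (p - 1)] (h : ZMod (p - 1) → ZMod p) :
    ∃ w : (ZMod p)ˣ → ZMod p, ∀ j : ℕ, h j = ∑ c, w c * (c : ZMod p) ^ j := by
  refine ⟨fun c => -∑ t, h t * (c : ZMod p) ^ (p - 1 - t.val), fun j => ?_⟩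
  simp only [neg_mul, Finset.sum_neg_distrib, Finset.sum_mul]
  rw [Finset.sum_comm]
  have key : ∀ t : ZMod (p - 1), ∑ c : (ZMod p)ˣ, h t * (c : ZMod p) ^ (p - 1 - t.val) * c ^ j =
      if t = j then - h t else 0 := by
    intro t
    have h1 := FiniteField.sum_pow_units (ZMod p) (p - 1 - t.val + j)
    simp only [mul_assoc, ← pow_add, ← Finset.mul_sum]
    rw [ZMod.card] at h1
    rw [h1]
    have h2 : p - 1 ∣ p - 1 - t.val + j ↔ t = j := by
      rw [← ZMod.natCast_eq_zero_iff, Nat.cast_add, Nat.cast_sub (ZMod.val_lt t).le,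
        ZMod.natCast_self, ZMod.natCast_zmod_val, zero_sub, neg_add_eq_zero]
    simp only [h2]
    split_ifs <;> simp
  simp only [key]
  simp

theorem range_le_Xr1Sub {p r : ℕ} [Fact p.Prime] [NeZero (p - 1)] (hr : 4 ≤ r) :
    LinearMap.range (formOf p r ∘ₗ coeffMap p r) ≤ Xr1Sub p r := by
  have hgen : ∀ a b c d : ZMod p, formOf p r (fun j =>
      b * (a ^ (r - 1 - j) * c ^ j * coeffX p r j) +
        d * (a ^ (r - j) * c ^ (j - 1) * coeffY p r j)) ∈ Xr1Sub p r := by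
    intro a b c d
    refine Submodule.subset_span ⟨!![a, b; c, d], ?_⟩
    simp [matAct_eq_formOf (show 1 ≤ r by omega)]
  have hX : ∀ c : ZMod p, formOf p r (fun j => c ^ j * coeffX p r j) ∈ Xr1Sub p r := by
    intro c
    simpa using hgen 1 1 c 0
  have hY : ∀ c : ZMod p, c ≠ 0 → formOf p r (fun j => c ^ j * coeffY p r j) ∈ Xr1Sub p r := by
    intro c hc
    have h1 := Submodule.smul_mem _ c (hgen 1 0 c 1)
    rw [← map_smul] at h1
    rw [formOf_congr (w := _) fun j _ => ?_]
    · exact h1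
    · rcases Nat.eq_zero_or_pos j with rfl | hj
      · simp [coeffY]
      · obtain ⟨i, rfl⟩ : ∃ i, j = i + 1 := ⟨j - 1, by omega⟩
        simp [pow_succ]
        ring
  have hs : ∀ i, (i = 0 ∨ i = 1 ∨ i + 1 = r ∨ i = r) →
      formOf p r (Pi.single i 1) ∈ Xr1Sub p r := by
    rintro i (rfl | rfl | hi | rfl)
    · convert hgen 1 1 0 0 using 2
      ext j
      rcases Nat.eq_zero_or_pos j with rfl | hj
      · simp [coeffX]
      · simp [hj.ne']
    · convert hgen 1 0 0 1 using 2
      ext j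
      rcases eq_or_ne j 1 with rfl | hj
      · simp [coeffY]
      · rcases Nat.eq_zero_or_pos j with rfl | hj'
        · simp [coeffY]
        · have : j - 1 ≠ 0 := by omega
          simp [hj, this]
    · convert hgen 0 1 1 0 using 1
      refine formOf_congr fun j hj => ?_
      rcases eq_or_ne j i with rfl | hji
      · simp [coeffX, ← hi]
      · rcases eq_or_ne j r with rfl | hjr
        · simp [hji, coeffX, Nat.choose_eq_zero_of_lt (show j - 1 < j by omega)]
        · have : r - 1 - j ≠ 0 := by omega
          simp [hji, this]
    · convert hgen 0 0 1 1 using 1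
      refine formOf_congr fun j hj => ?_
      rcases eq_or_ne j i with rfl | hji
      · simp [coeffY, show j ≠ 0 by omega]
      · have : i - j ≠ 0 := by omega
        simp [hji, this]
  rintro _ ⟨⟨x, f⟩, rfl⟩
  obtain ⟨w₁, h₁⟩ := exists_sum_units_eq fun t => (f t).1
  obtain ⟨w₂, h₂⟩ := exists_sum_units_eq fun t => (f t).2
  set u : ℕ → ZMod p := (∑ c, w₁ c • fun j => (c : ZMod p) ^ j * coeffX p r j) +
    ∑ c, w₂ c • fun j => (c : ZMod p) ^ j * coeffY p r j with hu
  have hmem : formOf p r u ∈ Xr1Sub p r := by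
    simp only [hu, map_add, map_sum, map_smul]
    exact Submodule.add_mem _ (Submodule.sum_mem _ fun c _ => Submodule.smul_mem _ _ (hX c))
      (Submodule.sum_mem _ fun c _ => Submodule.smul_mem _ _ (hY c c.ne_zero))
  have huj : ∀ j : ℕ, (f j).1 * coeffX p r j + (f j).2 * coeffY p r j = u j := by
    intro j
    simp only [hu, h₁, h₂, Pi.add_apply, Finset.sum_apply, Pi.smul_apply, smul_eq_mul,
      Finset.sum_mul, mul_assoc]
  have hdec : coeffMap p r (x, f) = u + (x 0 - u 0) • Pi.single 0 1 + (x 1 - u 1) • Pi.single 1 1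
      + (x 2 - u (r - 1)) • Pi.single (r - 1) 1 + (x 3 - u r) • Pi.single r 1 := by
    ext j
    rw [coeffMap_apply]
    simp only [huj, Pi.add_apply, Pi.smul_apply, smul_eq_mul, Pi.single_apply]
    have e : (j = r - 1) ↔ (j + 1 = r) := by omega
    simp only [e]
    split_ifs with h0 h1 h2 h3 <;> subst_vars <;> first | omega | simp
  rw [LinearMap.comp_apply, hdec]
  simp only [map_add, map_smul]
  refine Submodule.add_mem _ (Submodule.add_mem _ (Submodule.add_mem _ (Submodule.add_mem _ hmem
    ?_) ?_) ?_) ?_ <;> refine Submodule.smul_mem _ _ (hs _ ?_) <;> omega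

/-- The relations between the coefficients at the inner indices `j` in the class `t`. -/
def relSub (p r : ℕ) (t : ZMod (p - 1)) : Submodule (ZMod p) (ZMod p × ZMod p) where
  carrier := {w | ∀ j : ℕ, 2 ≤ j → j + 2 ≤ r → (j : ZMod (p - 1)) = t →
    w.1 * coeffX p r j + w.2 * coeffY p r j = 0}
  zero_mem' := by simp
  add_mem' {v w} hv hw j h1 h2 h3 := by
    simp only [Prod.fst_add, Prod.snd_add]
    linear_combination hv j h1 h2 h3 + hw j h1 h2 h3
  smul_mem' a w hw j h1 h2 h3 := by
    simp only [Prod.smul_fst, Prod.smul_snd, smul_eq_mul]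
    linear_combination a * hw j h1 h2 h3

theorem mem_relSub {p r : ℕ} {t : ZMod (p - 1)} {w : ZMod p × ZMod p} :
    w ∈ relSub p r t ↔ ∀ j : ℕ, 2 ≤ j → j + 2 ≤ r → (j : ZMod (p - 1)) = t →
      w.1 * coeffX p r j + w.2 * coeffY p r j = 0 := Iff.rfl

theorem mem_ker_iff {p r : ℕ} (hr : 4 ≤ r)
    (w : (Fin 4 → ZMod p) × (ZMod (p - 1) → ZMod p × ZMod p)) :
    w ∈ LinearMap.ker (formOf p r ∘ₗ coeffMap p r) ↔ w.1 = 0 ∧ ∀ t, w.2 t ∈ relSub p r t := by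
  rw [LinearMap.mem_ker, LinearMap.comp_apply, formOf_eq_zero_iff]
  constructor
  · intro h
    refine ⟨?_, fun t j h1 h2 h3 => ?_⟩
    · ext i
      fin_cases i
      · simpa [coeffMap_apply] using h 0 (by omega)
      · simpa [coeffMap_apply] using h 1 (by omega)
      · simpa [coeffMap_apply, show r - 1 ≠ 0 by omega, show r - 1 ≠ 1 by omega,
          show r - 1 + 1 = r by omega] using h (r - 1) (by omega)
      · simpa [coeffMap_apply, show r ≠ 0 by omega, show r ≠ 1 by omega] using h r le_rfl
    · have := h j (by omega)
      rwa [coeffMap_apply, if_neg (by omega), if_neg (by omega), if_neg (by omega),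
        if_neg (by omega), h3] at this
  · rintro ⟨h1, h2⟩ j hj
    rw [coeffMap_apply]
    split_ifs with h3 h4 h5 h6
    · rw [h1]; rfl
    · rw [h1]; rfl
    · rw [h1]; rfl
    · rw [h1]; rfl
    · exact h2 j j (by omega) (by omega) rfl

theorem finrank_Xr1Sub_add {p r : ℕ} [Fact p.Prime] [NeZero (p - 1)] (hr : 4 ≤ r) :
    Module.finrank (ZMod p) (Xr1Sub p r) + ∑ t, Module.finrank (ZMod p) (relSub p r t) =
      4 + 2 * (p - 1) := by
  have hrange : Xr1Sub p r = LinearMap.range (formOf p r ∘ₗ coeffMap p r) :=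
    le_antisymm (Xr1Sub_le_range hr) (range_le_Xr1Sub hr)
  let e : LinearMap.ker (formOf p r ∘ₗ coeffMap p r) ≃ₗ[ZMod p] (∀ t, relSub p r t) :=
    { toFun := fun w t => ⟨w.1.2 t, ((mem_ker_iff hr w.1).1 w.2).2 t⟩
      map_add' := fun _ _ => rfl
      map_smul' := fun _ _ => rfl
      invFun := fun f => ⟨(0, fun t => f t), (mem_ker_iff hr _).2 ⟨rfl, fun t => (f t).2⟩⟩
      left_inv := fun w => Subtype.ext (Prod.ext ((mem_ker_iff hr w.1).1 w.2).1.symm rfl)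
      right_inv := fun _ => rfl }
  rw [← Module.finrank_pi_fintype, ← e.finrank_eq, hrange, LinearMap.finrank_range_add_finrank_ker]
  simp [Module.finrank_prod, Module.finrank_pi_fintype, ZMod.card, mul_comm]

/-- If the relations in the class of `k` have dimension `2 - ρ k` for `1 ≤ k ≤ p - 1`, then
`X_{r-1}` has dimension `4 + ∑ ρ k`. -/
theorem finrank_Xr1Sub_eq {p r : ℕ} [Fact p.Prime] (hp : 3 ≤ p) (hr : 4 ≤ r) (ρ : ℕ → ℕ)
    (hρ : ∀ k ∈ Finset.Icc 1 (p - 1),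
      Module.finrank (ZMod p) (relSub p r (k : ZMod (p - 1))) + ρ k = 2) :
    Module.finrank (ZMod p) (Xr1Sub p r) = 4 + ∑ k ∈ Finset.Icc 1 (p - 1), ρ k := by
  have : NeZero (p - 1) := ⟨by omega⟩
  have h1 := finrank_Xr1Sub_add (p := p) hr
  have h2 : ∑ t, Module.finrank (ZMod p) (relSub p r t) =
      ∑ k ∈ Finset.Icc 1 (p - 1), Module.finrank (ZMod p) (relSub p r (k : ZMod (p - 1))) := by
    symm
    refine Finset.sum_nbij (fun k : ℕ => (k : ZMod (p - 1))) (fun _ _ => Finset.mem_univ _) ?_ ?_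
      fun _ _ => rfl
    · intro a ha b hb hab
      simp only [Finset.coe_Icc, Set.mem_Icc] at ha hb
      exact eq_of_natCast_eq ha.1 ha.2 hb.1 hb.2 hab
    · intro t _
      by_cases ht : t.val = 0
      · exact ⟨p - 1, by simp; omega, by simp [(ZMod.val_eq_zero t).1 ht]⟩
      · have := ZMod.val_lt t
        exact ⟨t.val, by simp; omega, by simp⟩
  have h3 := Finset.sum_congr rfl hρ
  rw [Finset.sum_add_distrib, ← h2] at h3
  simp at h3
  omega

theorem coeffX_add_coeffY {p r : ℕ} (hr : 1 ≤ r) (j : ℕ) :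
    coeffX p r j + coeffY p r j = (r.choose j : ZMod p) := by
  obtain ⟨m, rfl⟩ : ∃ m, r = m + 1 := ⟨r - 1, by omega⟩
  cases j with
  | zero => simp [coeffX, coeffY]
  | succ i => simp [coeffX, coeffY, Nat.choose_succ_succ, add_comm]

theorem mul_coeffX {p r j : ℕ} (hj : 1 ≤ j) (hjr : j ≤ r) :
    (j : ZMod p) * coeffX p r j = (r - j) * coeffY p r j := by
  obtain ⟨i, rfl⟩ : ∃ i, j = i + 1 := ⟨j - 1, by omega⟩
  have h := congrArg (Nat.cast (R := ZMod p)) (Nat.choose_succ_right_eq (r - 1) i)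
  rw [show r - 1 - i = r - (i + 1) by omega] at h
  simp only [Nat.cast_mul, Nat.cast_sub hjr] at h
  simp only [coeffX, coeffY, Nat.add_eq_zero_iff, one_ne_zero, and_false, if_false,
    Nat.add_sub_cancel]
  linear_combination h

theorem coeffX_ne_zero_iff {p r j : ℕ} : coeffX p r j ≠ 0 ↔ ¬ p ∣ (r - 1).choose j := by
  rw [coeffX, Ne, ZMod.natCast_eq_zero_iff]

theorem coeffY_ne_zero_iff {p r j : ℕ} (hj : 1 ≤ j) :
    coeffY p r j ≠ 0 ↔ ¬ p ∣ (r - 1).choose (j - 1) := by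
  rw [coeffY, if_neg (by omega), Ne, ZMod.natCast_eq_zero_iff]

theorem relSub_ne_top {p r j : ℕ} (h2 : 2 ≤ j) (hr : j + 2 ≤ r)
    (h : coeffX p r j ≠ 0 ∨ coeffY p r j ≠ 0) : relSub p r (j : ZMod (p - 1)) ≠ ⊤ := by
  intro htop
  rcases h with h | h
  · have := mem_relSub.1 (htop ▸ Submodule.mem_top : ((1, 0) : ZMod p × ZMod p) ∈ _) j h2 hr rfl
    simp [h] at this
  · have := mem_relSub.1 (htop ▸ Submodule.mem_top : ((0, 1) : ZMod p × ZMod p) ∈ _) j h2 hr rfl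
    simp [h] at this

theorem finrank_eq_one_of_mem {p : ℕ} [Fact p.Prime] {N : Submodule (ZMod p) (ZMod p × ZMod p)}
    {w : ZMod p × ZMod p} (hw : w ∈ N) (hw0 : w ≠ 0) (hN : N ≠ ⊤) :
    Module.finrank (ZMod p) N = 1 := by
  have h1 := Submodule.finrank_lt hN
  have h2 : 0 < Module.finrank (ZMod p) N :=
    Module.finrank_pos_iff_exists_ne_zero.2 ⟨⟨w, hw⟩, by simpa [Subtype.ext_iff] using hw0⟩
  rw [Module.finrank_prod, Module.finrank_self] at h1
  omega

theorem finrank_top_prod {p : ℕ} [Fact p.Prime] {N : Submodule (ZMod p) (ZMod p × ZMod p)}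
    (hN : N = ⊤) : Module.finrank (ZMod p) N = 2 := by
  rw [hN, finrank_top, Module.finrank_prod, Module.finrank_self]

theorem relSub_eq_bot_of_not_dvd {p r : ℕ} [Fact p.Prime] (hpr : ¬ p ∣ r) {t : ZMod (p - 1)}
    {i j : ℕ} (hi : 2 ≤ i) (hir : i + 2 ≤ r) (hit : (i : ZMod (p - 1)) = t)
    (hi0 : coeffX p r i ≠ 0 ∨ coeffY p r i ≠ 0)
    (hj : 2 ≤ j) (hjr : j + 2 ≤ r) (hjt : (j : ZMod (p - 1)) = t)
    (hj0 : coeffX p r j ≠ 0 ∨ coeffY p r j ≠ 0) (hij : (i : ZMod p) ≠ j) :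
    relSub p r t = ⊥ := by
  have hr0 : (r : ZMod p) ≠ 0 := by rwa [Ne, ZMod.natCast_eq_zero_iff]
  rw [eq_bot_iff]
  intro w hw
  have key : ∀ l : ℕ, 2 ≤ l → l + 2 ≤ r → (l : ZMod (p - 1)) = t →
      (coeffX p r l ≠ 0 ∨ coeffY p r l ≠ 0) → w.1 * r + (w.2 - w.1) * l = 0 := by
    intro l hl hlr hlt hl0
    have h1 := hw l hl hlr hlt
    have h2 := mul_coeffX (p := p) (show 1 ≤ l by omega) (show l ≤ r by omega)
    rcases hl0 with h | h
    · exact (mul_eq_zero.1 (show (w.1 * r + (w.2 - w.1) * l) * coeffX p r l = 0 by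
        linear_combination (r - l) * h1 + w.2 * h2)).resolve_right h
    · exact (mul_eq_zero.1 (show (w.1 * r + (w.2 - w.1) * l) * coeffY p r l = 0 by
        linear_combination l * h1 - w.1 * h2)).resolve_right h
  have h1 := key i hi hir hit hi0
  have h2 := key j hj hjr hjt hj0
  have h3 : w.2 - w.1 = 0 := (mul_eq_zero.1 (show (w.2 - w.1) * ((i : ZMod p) - j) = 0 by
    linear_combination h1 - h2)).resolve_right (sub_ne_zero.2 hij)
  have h4 : w.1 = 0 := by
    rw [h3, zero_mul, add_zero] at h1
    exact (mul_eq_zero.1 h1).resolve_right hr0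
  rw [h4, sub_zero] at h3
  exact Prod.ext h4 h3

theorem digits_sum_lt_of_coeffX_ne_zero {p r j : ℕ} [Fact p.Prime] (hj : 1 ≤ j) (hjr : j + 2 ≤ r)
    (h : coeffX p r j ≠ 0) :
    1 ≤ (p.digits j).sum ∧ (p.digits j).sum < (p.digits (r - 1)).sum := by
  have hp : 1 < p := (Fact.out : p.Prime).one_lt
  have h1 := digits_sum_add_of_not_dvd_choose (coeffX_ne_zero_iff.1 h)
  have h2 := (digits_sum_eq_zero_iff hp (m := j)).not.2 (by omega)
  have h3 := (digits_sum_eq_zero_iff hp (m := r - 1 - j)).not.2 (by omega)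
  omega

theorem coeffX_eq_coeffY_succ {p r j : ℕ} : coeffX p r j = coeffY p r (j + 1) := by
  simp [coeffX, coeffY]

theorem coeffX_eq_zero_of_le {p r j k : ℕ} [Fact p.Prime] (hp : 3 ≤ p)
    (hS : (p.digits (r - 1)).sum ≤ p - 1) (hk : 1 ≤ k) (hkp : k ≤ p - 1)
    (hSk : (p.digits (r - 1)).sum ≤ k) (hj : 2 ≤ j) (hjr : j + 2 ≤ r)
    (hjk : (j : ZMod (p - 1)) = k) : coeffX p r j = 0 := by
  by_contra h
  obtain ⟨h1, h2⟩ := digits_sum_lt_of_coeffX_ne_zero (by omega) hjr h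
  have := eq_of_natCast_eq h1 (by omega) hk hkp ((natCast_digits_sum hp j).trans hjk)
  omega

theorem coeffY_eq_zero_of_lt {p r j k : ℕ} [Fact p.Prime] (hp : 3 ≤ p)
    (hS : (p.digits (r - 1)).sum ≤ p - 1) (hk : 1 ≤ k) (hkp : k ≤ p - 1)
    (hSk : k = 1 ∨ (p.digits (r - 1)).sum < k) (hj : 2 ≤ j) (hjr : j + 2 ≤ r)
    (hjk : (j : ZMod (p - 1)) = k) : coeffY p r j = 0 := by
  by_contra h
  obtain ⟨i, rfl⟩ : ∃ i, j = i + 1 := ⟨j - 1, by omega⟩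
  rw [← coeffX_eq_coeffY_succ] at h
  obtain ⟨h1, h2⟩ := digits_sum_lt_of_coeffX_ne_zero (by omega) (by omega) h
  have := eq_of_natCast_eq (a := (p.digits i).sum + 1) (by omega) (by omega) hk hkp
    (by rw [Nat.cast_add, natCast_digits_sum hp, ← hjk, Nat.cast_add])
  omega

theorem mod_lt_pred_of_not_dvd {p r : ℕ} (hp : 1 < p) (hr : 1 ≤ r) (hpr : ¬ p ∣ r) :
    (r - 1) % p + 1 < p := by
  have h1 := Nat.mod_lt (r - 1) (show 0 < p by omega)
  by_contra! h
  have h2 := Nat.mod_add_div (r - 1) p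
  refine hpr ⟨(r - 1) / p + 1, ?_⟩
  rw [mul_add]
  omega

/-- For `p ∤ r` there are nonzero coefficients at inner indices with prescribed last digit `d` and
prescribed sum `s` of the remaining digits. -/
theorem exists_coeff_ne_zero {p r : ℕ} [Fact p.Prime] (hp : 3 ≤ p) (hr : 2 * p + 1 ≤ r)
    (hpr : ¬ p ∣ r) (d s : ℕ) (hd : d ≤ (r - 1) % p + 1) (hs : s ≤ (p.digits ((r - 1) / p)).sum)
    (h0 : s = 0 → 2 ≤ d) (h1 : s = (p.digits ((r - 1) / p)).sum → d + 1 ≤ (r - 1) % p) :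
    ∃ j, 2 ≤ j ∧ j + 2 ≤ r ∧ (j : ZMod (p - 1)) = ((d + s : ℕ) : ZMod (p - 1)) ∧
      (coeffX p r j ≠ 0 ∨ coeffY p r j ≠ 0) ∧ (j : ZMod p) = d := by
  have hm := mod_lt_pred_of_not_dvd (show 1 < p by omega) (by omega) hpr
  obtain ⟨i, hi, hi1, hi2⟩ := exists_digits_sum_eq (p := p) _ s hs
  have hdiv := Nat.mod_add_div (r - 1) p
  have hmul := Nat.mul_le_mul_left p hi
  have hlucas : ∀ e ≤ (r - 1) % p, ¬ p ∣ (r - 1).choose (e + p * i) := by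
    intro e he
    rw [not_dvd_choose_iff_lucas, Nat.add_mul_mod_self_left, Nat.mod_eq_of_lt (show e < p by omega),
      Nat.add_mul_div_left _ _ (show 0 < p by omega), Nat.div_eq_of_lt (show e < p by omega),
      zero_add]
    exact ⟨he, hi1⟩
  refine ⟨d + p * i, ?_, ?_, ?_, ?_, by simp⟩
  · rcases Nat.eq_zero_or_pos i with rfl | hi0
    · have := h0 (by simpa using hi2.symm)
      omega
    · have := Nat.mul_le_mul_left p hi0
      omega
  · rcases hi.eq_or_lt with rfl | hlt
    · have := h1 hi2.symm
      omega
    · have := Nat.mul_le_mul_left p (Nat.succ_le_of_lt hlt)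
      rw [Nat.mul_succ] at this
      omega
  · rw [← natCast_digits_sum hp, digits_sum_add_mul (by omega) (by omega), hi2]
  · rcases hd.eq_or_lt with rfl | hlt
    · right
      rw [show (r - 1) % p + 1 + p * i = (r - 1) % p + p * i + 1 by ring, ← coeffX_eq_coeffY_succ,
        coeffX_ne_zero_iff]
      exact hlucas _ le_rfl
    · exact Or.inl (coeffX_ne_zero_iff.2 (hlucas _ (by omega)))

theorem one_le_digits_sum_div {p r : ℕ} (hp : 1 < p) (hr : 2 * p + 1 ≤ r) :
    1 ≤ (p.digits ((r - 1) / p)).sum := by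
  refine Nat.one_le_iff_ne_zero.2 ((digits_sum_eq_zero_iff hp).not.2 ?_)
  exact (Nat.div_pos (by omega) (by omega)).ne'

theorem relSub_eq_bot_of_lt {p r k : ℕ} [Fact p.Prime] (hp : 3 ≤ p) (hr : 2 * p + 1 ≤ r)
    (hpr : ¬ p ∣ r) (hk : 2 ≤ k) (hkS : k < (p.digits (r - 1)).sum) :
    relSub p r (k : ZMod (p - 1)) = ⊥ := by
  have hS := one_le_digits_sum_div (show 1 < p by omega) hr
  rw [digits_sum_eq_mod_add (by omega)] at hkS
  obtain ⟨d, hd, hdk, hks⟩ : ∃ d ≤ (r - 1) % p, d + 1 ≤ k ∧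
      (k - d = 1 ∨ d = (r - 1) % p) := by
    rcases le_total (k - 1) ((r - 1) % p) with h | h
    · exact ⟨k - 1, h, by omega, by omega⟩
    · exact ⟨(r - 1) % p, le_rfl, by omega, Or.inr rfl⟩
  obtain ⟨i, hi, hir, hik, hi0, hid⟩ := exists_coeff_ne_zero hp hr hpr d (k - d) (by omega)
    (by omega) (by omega) (by omega)
  obtain ⟨j, hj, hjr, hjk, hj0, hjd⟩ := exists_coeff_ne_zero hp hr hpr (d + 1) (k - d - 1)
    (by omega) (by omega) (by omega) (by omega)
  refine relSub_eq_bot_of_not_dvd hpr hi hir ?_ hi0 hj hjr ?_ hj0 ?_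
  · rw [hik]; congr 1; omega
  · rw [hjk]; congr 1; omega
  · rw [hid, hjd]; simp

theorem natCast_self_pred {p : ℕ} (hp : 1 ≤ p) : (p : ZMod (p - 1)) = 1 := by
  obtain ⟨q, rfl⟩ : ∃ q, p = q + 1 := ⟨p - 1, by omega⟩
  simp

theorem relSub_eq_bot_of_le_digits_sum {p r k : ℕ} [Fact p.Prime] (hp : 3 ≤ p)
    (hr : 2 * p + 1 ≤ r) (hpr : ¬ p ∣ r) (hk : 1 ≤ k) (hkp : k ≤ p - 1)
    (hS : p ≤ (p.digits (r - 1)).sum) : relSub p r (k : ZMod (p - 1)) = ⊥ := by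
  rcases hk.eq_or_lt with rfl | hk
  · have hp1 : ((1 : ℕ) : ZMod (p - 1)) = (p : ℕ) := by
      rw [natCast_self_pred (by omega), Nat.cast_one]
    rcases hS.eq_or_lt with hS | hS
    · rw [digits_sum_eq_mod_add (by omega)] at hS
      have hm := mod_lt_pred_of_not_dvd (show 1 < p by omega) (by omega) hpr
      obtain ⟨i, hi, hir, hik, hi0, hid⟩ := exists_coeff_ne_zero hp hr hpr 0 1 (by omega)
        (by omega) (by omega) (by omega)
      obtain ⟨j, hj, hjr, hjk, hj0, hjd⟩ := exists_coeff_ne_zero hp hr hpr ((r - 1) % p + 1)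
        ((p.digits ((r - 1) / p)).sum - 1) (by omega) (by omega) (by omega) (by omega)
      refine relSub_eq_bot_of_not_dvd hpr hi hir hik hi0 hj hjr ?_ hj0 ?_
      · rw [hjk, hp1]; congr 1; omega
      · rw [hid, hjd, Ne, eq_comm, Nat.cast_zero, ZMod.natCast_eq_zero_iff]
        exact Nat.not_dvd_of_pos_of_lt (by omega) hm
    · rw [hp1]
      exact relSub_eq_bot_of_lt hp hr hpr (by omega) hS
  · exact relSub_eq_bot_of_lt hp hr hpr hk (by omega)

theorem finrank_Xr1Sub_of_not_dvd {p r : ℕ} [Fact p.Prime] (hp : 3 ≤ p) (hr : 2 * p + 1 ≤ r)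
    (hpr : ¬ p ∣ r) (hS : (p.digits (r - 1)).sum ≤ p - 1) :
    Module.finrank (ZMod p) (Xr1Sub p r) = 2 * (p.digits (r - 1)).sum + 2 := by
  have hS' := one_le_digits_sum_div (show 1 < p by omega) hr
  have hmod := digits_sum_eq_mod_add (show 1 < p by omega) (r - 1)
  have hm := mod_lt_pred_of_not_dvd (show 1 < p by omega) (by omega) hpr
  set S := (p.digits (r - 1)).sum with hSdef
  rw [finrank_Xr1Sub_eq hp (by omega) fun k => (if k < S then 1 else 0) + if 2 ≤ k ∧ k ≤ S then 1
    else 0]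
  · rw [Finset.sum_add_distrib, Finset.sum_boole, Finset.sum_boole,
      show {k ∈ Finset.Icc 1 (p - 1) | k < S} = Finset.Icc 1 (S - 1) by ext; simp; omega,
      show {k ∈ Finset.Icc 1 (p - 1) | 2 ≤ k ∧ k ≤ S} = Finset.Icc 2 S by ext; simp; omega]
    simp
    omega
  intro k hk
  obtain ⟨hk, hkp⟩ := Finset.mem_Icc.1 hk
  rcases lt_or_ge k S with h1 | h1
  · rcases hk.eq_or_lt with rfl | h2
    · obtain ⟨i, hi, hir, hik, hi0, -⟩ := exists_coeff_ne_zero hp hr hpr 0 1 (by omega)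
        (by omega) (by omega) (by omega)
      have hone : Module.finrank (ZMod p) (relSub p r ((1 : ℕ) : ZMod (p - 1))) = 1 := by
        refine finrank_eq_one_of_mem (w := (0, 1)) (fun j hj hjr hjk => ?_) (by simp) ?_
        · simp [coeffY_eq_zero_of_lt hp hS hk hkp (Or.inl rfl) hj hjr hjk]
        · exact hik ▸ relSub_ne_top hi hir hi0
      rw [hone]
      simp [h1]
    · rw [relSub_eq_bot_of_lt hp hr hpr h2 h1]
      simp [h1, h1.le, show 2 ≤ k from h2]
  · by_cases h2 : k = 1 ∨ S < k
    · rw [finrank_top_prod, if_neg (by omega), if_neg (by omega)]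
      rw [eq_top_iff]
      intro w _ j hj hjr hjk
      simp [coeffX_eq_zero_of_le hp hS hk hkp h1 hj hjr hjk,
        coeffY_eq_zero_of_lt hp hS hk hkp h2 hj hjr hjk]
    · obtain ⟨i, hi, hir, hik, hi0, -⟩ := exists_coeff_ne_zero hp hr hpr ((r - 1) % p + 1)
        ((p.digits ((r - 1) / p)).sum - 1) (by omega) (by omega) (by omega) (by omega)
      rw [finrank_eq_one_of_mem (w := (1, 0)), if_neg (by omega), if_pos (by omega)]
      · intro j hj hjr hjk
        simp [coeffX_eq_zero_of_le hp hS hk hkp h1 hj hjr hjk]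
      · simp
      · rw [show (k : ZMod (p - 1)) = i by rw [hik]; congr 1; omega]
        exact relSub_ne_top hi hir hi0

theorem pred_mod_of_dvd {p r : ℕ} (hp : 1 < p) (hr : 1 ≤ r) (hpr : p ∣ r) :
    (r - 1) % p = p - 1 ∧ (r - 1) / p = r / p - 1 := by
  obtain ⟨q, rfl⟩ := hpr
  obtain ⟨q, rfl⟩ : ∃ i, q = i + 1 := ⟨q - 1, by
    have : q ≠ 0 := by rintro rfl; simp at hr
    omega⟩
  have h : p * (q + 1) - 1 = (p - 1) + p * q := by rw [mul_add]; omega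
  rw [h, Nat.add_mul_mod_self_left, Nat.mod_eq_of_lt (by omega),
    Nat.add_mul_div_left _ _ (by omega), Nat.div_eq_of_lt (by omega),
    Nat.mul_div_cancel_left _ (by omega)]
  simp

theorem dvd_choose_of_not_dvd {p r j : ℕ} [Fact p.Prime] (hpr : p ∣ r) (hj : ¬ p ∣ j) :
    p ∣ r.choose j := by
  by_contra h
  have h1 := ((not_dvd_choose_iff_lucas r j).1 h).1
  rw [Nat.mod_eq_zero_of_dvd hpr] at h1
  exact hj (Nat.dvd_of_mod_eq_zero (by omega))

theorem digits_sum_of_not_dvd {p u : ℕ} (hp : 1 < p) (hu : ¬ p ∣ u) :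
    (p.digits u).sum = (p.digits (u - 1)).sum + 1 := by
  have hu0 : u ≠ 0 := by rintro rfl; simp at hu
  have h1 := mod_lt_pred_of_not_dvd hp (by omega) hu
  have h2 := Nat.mod_add_div (u - 1) p
  have h3 : u = ((u - 1) % p + 1) + p * ((u - 1) / p) := by omega
  conv_lhs => rw [h3]
  rw [digits_sum_add_mul hp h1, digits_sum_eq_mod_add hp (u - 1)]
  ring

/-- For `p ∣ r`, an index in the class of `k` where `coeffX` and `coeffY` are nonzero and
opposite. -/
theorem exists_coeff_add_eq_zero {p r n u k : ℕ} [Fact p.Prime] (hp : 3 ≤ p) (hr : 2 * p + 1 ≤ r)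
    (hru : r = p ^ (n + 1) * u) (hk : 1 ≤ k) (hkp : k ≤ p - 1)
    (h : 2 ≤ k ∨ 1 ≤ n ∨ 2 ≤ (p.digits (u - 1)).sum) :
    ∃ j, 2 ≤ j ∧ j + 2 ≤ r ∧ (j : ZMod (p - 1)) = k ∧ coeffX p r j ≠ 0 ∧
      coeffX p r j + coeffY p r j = 0 := by
  have hpr : p ∣ r := ⟨p ^ n * u, by rw [hru]; ring⟩
  have hrp : r / p = p ^ n * u := by
    rw [hru, pow_succ', mul_assoc, Nat.mul_div_cancel_left _ (by omega)]
  obtain ⟨hm, hd⟩ := pred_mod_of_dvd (show 1 < p by omega) (by omega) hpr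
  simp only [coeffX_add_coeffY (show 1 ≤ r by omega), ZMod.natCast_eq_zero_iff, coeffX_ne_zero_iff]
  rcases hk.eq_or_lt with rfl | hk
  · rcases Nat.eq_zero_or_pos n with rfl | hn
    · have hS : 2 ≤ (p.digits (u - 1)).sum := by omega
      obtain ⟨i, hi, hi1, hi2⟩ := exists_digits_sum_eq (p := p) (u - 1) 1 (by omega)
      have hlt : i < u - 1 := lt_of_le_of_ne hi (by rintro rfl; omega)
      have h1 := Nat.mul_le_mul_left p (show i + 2 ≤ u by omega)
      have h2 : r = p * u := by rw [hru]; ring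
      rw [Nat.mul_add] at h1
      refine ⟨p - 1 + p * i, by omega, by omega, ?_, ?_, dvd_choose_of_not_dvd hpr ?_⟩
      · rw [← natCast_digits_sum hp, digits_sum_add_mul (by omega) (by omega), hi2]
        simp
      · rw [not_dvd_choose_iff_lucas, hm, hd, hrp, Nat.add_mul_mod_self_left,
          Nat.mod_eq_of_lt (show p - 1 < p by omega), Nat.add_mul_div_left _ _ (by omega),
          Nat.div_eq_of_lt (show p - 1 < p by omega)]
        simpa using hi1
      · rw [Nat.dvd_add_left (dvd_mul_right _ _)]
        exact Nat.not_dvd_of_pos_of_lt (by omega) (by omega)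
    · have hpd : p ∣ r / p := by
        rw [hrp]
        exact dvd_mul_of_dvd_left (dvd_pow_self p (by omega)) _
      have hpos : 1 ≤ r / p := Nat.div_pos (by omega) (by omega)
      refine ⟨p, by omega, by omega, by rw [natCast_self_pred (by omega), Nat.cast_one], ?_, ?_⟩
      · rw [not_dvd_choose_iff_lucas, hm, hd, Nat.mod_self, Nat.div_self (by omega),
          Nat.choose_one_right]
        refine ⟨Nat.zero_le _, fun h3 => ?_⟩
        have := (Nat.dvd_sub_iff_right hpos hpd).1 h3
        have := Nat.le_of_dvd one_pos this
        omega
      · by_contra h3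
        have := ((not_dvd_choose_iff_lucas r p).1 h3).2
        rw [Nat.div_self (by omega), Nat.choose_one_right] at this
        exact this hpd
  · refine ⟨k, hk, by omega, rfl, ?_, dvd_choose_of_not_dvd hpr
      (Nat.not_dvd_of_pos_of_lt (by omega) (by omega))⟩
    rw [not_dvd_choose_iff_lucas, hm, Nat.mod_eq_of_lt (show k < p by omega),
      Nat.div_eq_of_lt (show k < p by omega)]
    simp
    omega

theorem relSub_one_eq_bot {p u : ℕ} [Fact p.Prime] (hp : 3 ≤ p) (hr : 2 * p + 1 ≤ p * u)
    (hS : (p.digits (u - 1)).sum = 1) : relSub p (p * u) 1 = ⊥ := by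
  have hu : 3 ≤ u := by
    by_contra! h
    have := Nat.mul_le_mul_left p (show u ≤ 2 by omega)
    omega
  have hdvd : p ∣ u - 1 := by
    rw [digits_sum_eq_mod_add (by omega)] at hS
    by_contra h
    have h1 : (u - 1) % p ≠ 0 := fun h2 => h (Nat.dvd_of_mod_eq_zero h2)
    have h2 := (digits_sum_eq_zero_iff (show 1 < p by omega) (m := (u - 1) / p)).1 (by omega)
    have h3 := Nat.mod_add_div (u - 1) p
    rw [h2] at h3
    omega
  obtain ⟨hm, hd⟩ := pred_mod_of_dvd (show 1 < p by omega) (by omega) (dvd_mul_right p u)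
  rw [Nat.mul_div_cancel_left _ (by omega)] at hd
  have hpu : p * u - p = p * (u - 1) := by rw [Nat.mul_sub, mul_one]
  have hA : ¬ p ∣ (p * u - 1).choose (p - 1) := by
    rw [not_dvd_choose_iff_lucas, hm, Nat.mod_eq_of_lt (show p - 1 < p by omega),
      Nat.div_eq_of_lt (show p - 1 < p by omega)]
    simp
    omega
  have hB : p ∣ (p * u - 1).choose p := by
    by_contra h
    have := ((not_dvd_choose_iff_lucas _ p).1 h).2
    rw [hd, Nat.div_self (by omega), Nat.choose_one_right] at this
    exact this hdvd
  have hX : coeffX p (p * u) p = 0 := by rwa [coeffX, ZMod.natCast_eq_zero_iff]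
  have hY : coeffY p (p * u) p ≠ 0 := (coeffY_ne_zero_iff (by omega)).2 hA
  have hX' : coeffX p (p * u) (p * u - p) ≠ 0 := by
    rw [coeffX_ne_zero_iff, ← Nat.choose_symm (by omega)]
    rwa [show p * u - 1 - (p * u - p) = p - 1 by omega]
  have hcl : ((p * u - p : ℕ) : ZMod (p - 1)) = 1 := by
    rw [hpu, Nat.cast_mul, ← natCast_digits_sum hp (u - 1), hS, natCast_self_pred (by omega)]
    simp
  rw [eq_bot_iff]
  intro w hw
  have h1 := hw p (by omega) (by omega) (natCast_self_pred (by omega))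
  have h2 : w.2 = 0 := by simpa [hX, hY] using h1
  have h3 := hw (p * u - p) (by omega) (by omega) hcl
  have h4 : w.1 = 0 := by simpa [h2, hX'] using h3
  exact Prod.ext h4 h2

theorem finrank_relSub_of_dvd {p r n u k : ℕ} [Fact p.Prime] (hp : 3 ≤ p) (hr : 2 * p + 1 ≤ r)
    (hru : r = p ^ (n + 1) * u) (hu : ¬ p ∣ u) (hk : 1 ≤ k) (hkp : k ≤ p - 1) :
    Module.finrank (ZMod p) (relSub p r (k : ZMod (p - 1))) +
      (1 + if k ≤ (p.digits (u - 1)).sum then 1 else 0) = 2 := by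
  have hpr : p ∣ r := ⟨p ^ n * u, by rw [hru]; ring⟩
  have hSr : (p.digits r).sum = (p.digits (u - 1)).sum + 1 := by
    rw [hru, digits_sum_pow_mul (by omega), digits_sum_of_not_dvd (by omega) hu]
  have hu0 : u ≠ 0 := by rintro rfl; simp at hu
  split_ifs with hkS
  · suffices h : relSub p r (k : ZMod (p - 1)) = ⊥ by rw [h]; simp
    by_cases hex : 2 ≤ k ∨ 1 ≤ n ∨ 2 ≤ (p.digits (u - 1)).sum
    · obtain ⟨i, hi, hir, hik, hi1, hi2⟩ := exists_coeff_add_eq_zero hp hr hru hk hkp hex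
      obtain ⟨j, hj, hj1, hj2⟩ := exists_digits_sum_eq (p := p) r k (by omega)
      have hpj : p ∣ j := by
        by_contra h
        exact hj1 (dvd_choose_of_not_dvd hpr h)
      have hj0 : j ≠ 0 := by rintro rfl; simp at hj2; omega
      have hjr : j ≠ r := by rintro rfl; omega
      have h1 := Nat.le_of_dvd (by omega) hpj
      have h2 := Nat.le_of_dvd (by omega) (Nat.dvd_sub hpr hpj)
      rw [eq_bot_iff]
      intro w hw
      have h3 := hw i hi hir hik
      have h4 := hw j (by omega) (by omega) (by rw [← natCast_digits_sum hp, hj2])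
      have h5 : coeffX p r j + coeffY p r j ≠ 0 := by
        rwa [coeffX_add_coeffY (by omega), Ne, ZMod.natCast_eq_zero_iff]
      have h6 : w.1 - w.2 = 0 := (mul_eq_zero.1 (show (w.1 - w.2) * coeffX p r i = 0 by
        linear_combination h3 - w.2 * hi2)).resolve_right hi1
      have h7 : w.1 = 0 := (mul_eq_zero.1 (show w.1 * (coeffX p r j + coeffY p r j) = 0 by
        linear_combination h4 + coeffY p r j * h6)).resolve_right h5
      rw [h7, zero_sub, neg_eq_zero] at h6
      exact Prod.ext h7 h6
    · obtain rfl : k = 1 := by omega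
      obtain rfl : n = 0 := by omega
      have h1 : r = p * u := by rw [hru]; ring
      subst h1
      rw [Nat.cast_one]
      exact relSub_one_eq_bot hp hr (by omega)
  · have hn : 2 ≤ k ∨ 1 ≤ n := by
      by_contra! h
      have h1 := (digits_sum_eq_zero_iff (show 1 < p by omega) (m := u - 1)).1 (by omega)
      obtain rfl : n = 0 := by omega
      obtain rfl : u = 1 := by omega
      simp at hru
      omega
    obtain ⟨i, hi, hir, hik, hi1, -⟩ := exists_coeff_add_eq_zero hp hr hru hk hkp
      (hn.imp_right Or.inl)
    rw [finrank_eq_one_of_mem (w := (1, 1)) _ (by simp) (hik ▸ relSub_ne_top hi hir (Or.inl hi1))]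
    intro j hj hjr hjk
    simp only [one_mul]
    rw [coeffX_add_coeffY (by omega), ZMod.natCast_eq_zero_iff]
    by_contra h
    have h1 := digits_sum_add_of_not_dvd_choose h
    have h2 := (digits_sum_eq_zero_iff (show 1 < p by omega) (m := j)).not.2 (by omega)
    have h3 := (digits_sum_eq_zero_iff (show 1 < p by omega) (m := r - j)).not.2 (by omega)
    have := eq_of_natCast_eq (by omega) (by omega) hk hkp ((natCast_digits_sum hp j).trans hjk)
    omega

theorem finrank_Xr1Sub_of_dvd {p r n u : ℕ} [Fact p.Prime] (hp : 3 ≤ p) (hr : 2 * p + 1 ≤ r)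
    (hru : r = p ^ (n + 1) * u) (hu : ¬ p ∣ u) :
    Module.finrank (ZMod p) (Xr1Sub p r) = p + 3 + min (p - 1) (p.digits (u - 1)).sum := by
  rw [finrank_Xr1Sub_eq hp (by omega) _ fun k hk =>
    finrank_relSub_of_dvd hp hr hru hu (Finset.mem_Icc.1 hk).1 (Finset.mem_Icc.1 hk).2]
  rw [Finset.sum_add_distrib, Finset.sum_boole,
    show {k ∈ Finset.Icc 1 (p - 1) | k ≤ (p.digits (u - 1)).sum} =
      Finset.Icc 1 (min (p - 1) (p.digits (u - 1)).sum) by ext; simp; omega]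
  simp only [Finset.sum_const, Nat.card_Icc, Nat.add_sub_cancel, smul_eq_mul, mul_one, Nat.cast_id]
  omega
/-- For a prime `p ≥ 3` and `r ≥ 2p+1`, writing `r = p^n u` with `p ∤ u`,
`δ = 0` if `r = u` and `δ = 1` otherwise, and `Σ = Σ_p(u−1)`, the dimension of `X_{r−1}` is
`2Σ + 2 + δ(p + 1 − Σ)` if `Σ ≤ p − 1`, and `2p + 2` if `Σ > p − 1`. -/
theorem dim_Xr1_formula (p r n u : ℕ) (hp : p.Prime) (hp3 : 3 ≤ p)
    (hr : 2 * p + 1 ≤ r) (hru : r = p ^ n * u) (hu : ¬ p ∣ u) :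
    ((Nat.digits p (u - 1)).sum ≤ p - 1 →
      Module.finrank (ZMod p) ↥(Xr1Sub p r) =
        2 * (Nat.digits p (u - 1)).sum + 2 +
          (if r = u then 0 else 1) * (p + 1 - (Nat.digits p (u - 1)).sum)) ∧
    (p - 1 < (Nat.digits p (u - 1)).sum →
      Module.finrank (ZMod p) ↥(Xr1Sub p r) = 2 * p + 2) := by
  have : Fact p.Prime := ⟨hp⟩
  rcases n with _ | n
  · obtain rfl : r = u := by simpa using hru
    refine ⟨fun hS => by simpa using finrank_Xr1Sub_of_not_dvd hp3 hr hu hS, fun hS => ?_⟩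
    rw [finrank_Xr1Sub_eq hp3 (by omega) (fun _ => 2)]
    · simp
      omega
    · intro k hk
      rw [Finset.mem_Icc] at hk
      rw [relSub_eq_bot_of_le_digits_sum hp3 hr hu hk.1 hk.2 (by omega)]
      simp
  · have hne : r ≠ u := by
      rintro rfl
      exact hu (hru ▸ dvd_mul_of_dvd_left (dvd_pow_self p n.succ_ne_zero) _)
    rw [finrank_Xr1Sub_of_dvd hp3 hr hru hu, if_neg hne]
    omega
end

section
/- Let p ≥ 3 be a prime, r > p an integer with r ≡ 1 mod (p−1) and Σ_p(r−1) = p−1 (so in particular p ∤ r). Then there is an M-equivariant F_p-linear isomorphism X_{r−1} ≅ V_{2p−1}. -/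
open MvPolynomial

/-- The sum of the base-`p` digits of `n`. -/
abbrev digitSum (p n : ℕ) : ℕ := (Nat.digits p n).sum

theorem digitSum_add_mul {p i : ℕ} (hp : 1 < p) (hi : i < p) (m : ℕ) :
    digitSum p (i + p * m) = i + digitSum p m := by
  by_cases h : i ≠ 0 ∨ m ≠ 0
  · rw [digitSum, Nat.digits_add p hp i m hi h, List.sum_cons]
  · push Not at h
    simp [h.1, h.2, digitSum]

theorem digitSum_eq_mod_add_div {p : ℕ} (hp : 1 < p) (n : ℕ) :
    digitSum p n = n % p + digitSum p (n / p) := by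
  conv_lhs => rw [← Nat.mod_add_div n p]
  exact digitSum_add_mul hp (Nat.mod_lt _ (by lia)) _

theorem digitSum_pos {p n : ℕ} (hp : 1 < p) (hn : 0 < n) : 0 < digitSum p n := by
  induction n using Nat.strong_induction_on with
  | _ n ih =>
    rw [digitSum_eq_mod_add_div hp]
    rcases Nat.eq_zero_or_pos (n % p) with h | h
    · have hd : 0 < n / p :=
        Nat.div_pos (Nat.le_of_dvd hn (Nat.dvd_of_mod_eq_zero h)) (by lia)
      have := ih (n / p) (Nat.div_lt_self hn hp) hd
      lia
    · lia

theorem pow_digitSum (p : ℕ) [Fact p.Prime] (a : ZMod p) (n : ℕ) :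
    a ^ digitSum p n = a ^ n := by
  have hp : 1 < p := (Fact.out : p.Prime).one_lt
  induction n using Nat.strong_induction_on with
  | _ n ih =>
    rcases Nat.eq_zero_or_pos n with rfl | hn
    · simp [digitSum]
    · rw [digitSum_eq_mod_add_div hp, pow_add, ih _ (Nat.div_lt_self hn hp)]
      conv_rhs => rw [← Nat.mod_add_div n p, pow_add, pow_mul, ZMod.pow_card]

theorem choose_add_mul (p : ℕ) [Fact p.Prime] {i : ℕ} (hi : i < p) (s m : ℕ) :
    (s.choose (i + p * m) : ZMod p) =
      ((s % p).choose i : ZMod p) * ((s / p).choose m : ZMod p) := by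
  have hp : 0 < p := (Fact.out : p.Prime).pos
  have := (ZMod.natCast_eq_natCast_iff _ _ _).2
    (Choose.choose_modEq_choose_mod_mul_choose_div_nat (n := s) (k := i + p * m) (p := p))
  rw [this, Nat.add_mul_mod_self_left, Nat.mod_eq_of_lt hi, Nat.add_mul_div_left _ _ hp,
    Nat.div_eq_of_lt hi, zero_add, Nat.cast_mul]

theorem digitSum_add_of_choose_ne_zero {p : ℕ} [Fact p.Prime] {n k : ℕ}
    (h : ((n.choose k : ℕ) : ZMod p) ≠ 0) :
    digitSum p k + digitSum p (n - k) = digitSum p n := by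
  have hp : 1 < p := (Fact.out : p.Prime).one_lt
  induction n using Nat.strong_induction_on generalizing k with
  | _ n ih =>
    rcases Nat.eq_zero_or_pos n with rfl | hn
    · rcases k with _ | k
      · simp [digitSum]
      · simp at h
    rw [← Nat.mod_add_div k p, choose_add_mul p (Nat.mod_lt _ (by lia))] at h
    have hmod : k % p ≤ n % p := by
      by_contra hk
      simp [Nat.choose_eq_zero_of_lt (not_le.1 hk)] at h
    have hdiv : k / p ≤ n / p := by
      by_contra hk
      simp [Nat.choose_eq_zero_of_lt (not_le.1 hk)] at h
    have hsub : n - k = (n % p - k % p) + p * (n / p - k / p) := by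
      have := Nat.mul_le_mul_left p hdiv
      rw [Nat.mul_sub]
      have := Nat.mod_add_div n p
      have := Nat.mod_add_div k p
      lia
    have hlt : n % p < p := Nat.mod_lt _ (by lia)
    have := ih _ (Nat.div_lt_self hn hp) (right_ne_zero_of_mul h)
    rw [hsub, digitSum_add_mul hp (by lia), digitSum_eq_mod_add_div hp k,
      digitSum_eq_mod_add_div hp n]
    lia

theorem choose_mul_pow_eq {p s : ℕ} [Fact p.Prime] (hs : digitSum p s = p - 1) (j : ℕ)
    (a c : ZMod p) :
    (s.choose j : ZMod p) * (a ^ (p - 1 - digitSum p j) * c ^ digitSum p j) =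
      (s.choose j : ZMod p) * (a ^ (s - j) * c ^ j) := by
  by_cases h : ((s.choose j : ℕ) : ZMod p) = 0
  · simp [h]
  · have := digitSum_add_of_choose_ne_zero h
    rw [show p - 1 - digitSum p j = digitSum p (s - j) by lia, pow_digitSum, pow_digitSum]

theorem choose_ne_zero_of_lt_prime {p : ℕ} [hp : Fact p.Prime] {n k : ℕ} (hn : n < p)
    (hk : k ≤ n) : (n.choose k : ZMod p) ≠ 0 := fun h =>
  ((Nat.Prime.coprime_iff_not_dvd hp.out).1 (hp.out.coprime_choose_of_lt hn hk))
    ((ZMod.natCast_eq_zero_iff _ _).1 h)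

theorem exists_digitSum_eq_choose_ne_zero (p : ℕ) [Fact p.Prime] (n t : ℕ)
    (ht : t ≤ digitSum p n) :
    ∃ m, digitSum p m = t ∧ (n.choose m : ZMod p) ≠ 0 := by
  have hp : 1 < p := (Fact.out : p.Prime).one_lt
  induction n using Nat.strong_induction_on generalizing t with
  | _ n ih =>
    rcases Nat.eq_zero_or_pos n with rfl | hn
    · exact ⟨0, by simpa [digitSum, eq_comm] using ht⟩
    · have hd := Nat.div_lt_self hn hp
      rw [digitSum_eq_mod_add_div hp] at ht
      have hmod : n % p < p := Nat.mod_lt _ (by lia)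
      obtain ⟨m, hm, hc⟩ := ih (n / p) hd (min t (digitSum p (n / p))) (min_le_right _ _)
      have hi : t - min t (digitSum p (n / p)) ≤ n % p := by lia
      refine ⟨t - min t (digitSum p (n / p)) + p * m, ?_, ?_⟩
      · rw [digitSum_add_mul hp (by lia), hm]
        lia
      · rw [choose_add_mul p (by lia)]
        exact mul_ne_zero (choose_ne_zero_of_lt_prime hmod hi) hc

theorem eq_zero_of_choose_relations {p s : ℕ} [Fact p.Prime] (hs : digitSum p s = p - 1)
    (hps : p ≤ s) {α β : ℕ → ZMod p} (h0 : α 0 = 0)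
    (h : ∀ n, (s.choose (n + 1) : ZMod p) * α (digitSum p (n + 1)) +
      (s.choose n : ZMod p) * β (digitSum p n) = 0) {k : ℕ} (hk : k < p) :
    α k = 0 ∧ β k = 0 := by
  have hp : 1 < p := (Fact.out : p.Prime).one_lt
  obtain ⟨d, hd⟩ : ∃ d, s % p = d := ⟨_, rfl⟩
  obtain ⟨q, hq⟩ : ∃ q, digitSum p (s / p) = q := ⟨_, rfl⟩
  have hq1 : 1 ≤ q := hq ▸ digitSum_pos hp (Nat.div_pos hps (by lia))
  have hdq : d + q = p - 1 := by rw [← hs, digitSum_eq_mod_add_div hp s, hd, hq]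
  have hm (t : ℕ) (ht : t ≤ q) := exists_digitSum_eq_choose_ne_zero p (s / p) t (hq ▸ ht)
  have hne (n : ℕ) (h1 : 0 < n) (h2 : n < p) : (n : ZMod p) ≠ 0 := fun hz =>
    Nat.not_dvd_of_pos_of_lt h1 h2 ((ZMod.natCast_eq_zero_iff _ _).1 hz)
  have hα (t : ℕ) (ht : t ≤ q) : α t = 0 := by
    obtain ⟨m, rfl, hc⟩ := hm t ht
    rcases m with _ | m
    · simpa [digitSum] using h0
    · have key := h (p - 1 + p * m)
      rw [show p - 1 + p * m + 1 = 0 + p * (m + 1) by rw [mul_add]; lia,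
        choose_add_mul p (by lia), choose_add_mul p (by lia), digitSum_add_mul hp (by lia), hd,
        Nat.choose_eq_zero_of_lt (show d < p - 1 by lia)] at key
      simpa [hc] using key
  have hβ (t : ℕ) (ht : t ≤ q) : β (d + t) = 0 := by
    obtain ⟨m, rfl, hc⟩ := hm t ht
    have key := h (d + p * m)
    rw [show d + p * m + 1 = (d + 1) + p * m by lia,
      choose_add_mul p (by lia), choose_add_mul p (by lia), digitSum_add_mul hp (by lia),
      digitSum_add_mul hp (by lia), hd, Nat.choose_eq_zero_of_lt (Nat.lt_succ_self d)] at key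
    simpa [hc] using key
  have hαβ (i t : ℕ) (hi : i < d) (ht : t ≤ q) :
      ((d : ZMod p) - i) * α (i + t + 1) + (i + 1) * β (i + t) = 0 := by
    obtain ⟨m, rfl, hc⟩ := hm t ht
    have key := h (i + p * m)
    rw [show i + p * m + 1 = (i + 1) + p * m by lia,
      choose_add_mul p (by lia), choose_add_mul p (by lia), digitSum_add_mul hp (by lia),
      digitSum_add_mul hp (by lia), hd, show i + 1 + digitSum p m = i + digitSum p m + 1 by lia]
      at key
    have hr : (d.choose (i + 1) : ZMod p) * (i + 1) = d.choose i * ((d : ZMod p) - i) := by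
      have := congrArg (Nat.cast (R := ZMod p)) (Nat.choose_succ_right_eq d i)
      push_cast [Nat.cast_sub hi.le] at this
      exact this
    have hci := choose_ne_zero_of_lt_prime (p := p) (show d < p by lia) hi.le
    refine (mul_eq_zero.1 ?_).resolve_left (mul_ne_zero hci hc)
    linear_combination ((i : ZMod p) + 1) * key -
      (s / p).choose m * α (i + digitSum p m + 1) * hr
  have hstep (k : ℕ) (hk : k + 1 < p) : α (k + 1) = 0 ∧ β k = 0 := by
    rcases Nat.eq_zero_or_pos d with rfl | hd0
    · exact ⟨hα _ (by lia), by simpa using hβ k (by lia)⟩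
    rcases Nat.lt_or_ge k q with hkq | hkq
    · have ha := hα (k + 1) hkq
      have := hαβ 0 k hd0 hkq.le
      simp only [zero_add] at this
      exact ⟨ha, by simpa [ha] using this⟩
    rcases Nat.lt_or_ge k d with hkd | hkd
    · have e1 := hαβ k 0 hkd (by lia)
      have e2 := hαβ (k - 1) 1 (by lia) hq1
      rw [add_zero] at e1
      rw [Nat.sub_add_cancel (by lia), Nat.cast_sub (by lia)] at e2
      push_cast at e2
      have e3 : α (k + 1) = β k := by linear_combination e2 - e1
      have e4 : ((d + 1 : ℕ) : ZMod p) * β k = 0 := by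
        push_cast
        linear_combination e1 - ((d : ZMod p) - k) * e3
      have hb := (mul_eq_zero.1 e4).resolve_left (hne _ (by lia) (by lia))
      exact ⟨e3.trans hb, hb⟩
    · have hb : β k = 0 := by simpa [Nat.add_sub_cancel' hkd] using hβ (k - d) (by lia)
      have := hαβ (d - 1) (k + 1 - d) (by lia) (by lia)
      rw [show d - 1 + (k + 1 - d) = k by lia, hb, Nat.cast_sub hd0] at this
      exact ⟨by simpa using this, hb⟩
  refine ⟨?_, ?_⟩
  · rcases k with _ | k
    · exact h0
    · exact (hstep k hk).1
  · rcases Nat.lt_or_ge (k + 1) p with hk' | hk'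
    · exact (hstep k hk').2
    · have := hβ q le_rfl
      rwa [show d + q = k by lia] at this

/-- The linear map sending a pair of coefficient vectors to the polynomial
`∑ i, ∑ j, C(s, j) u_i(Σ_p(j)) X^(s-j) Y^j X_i`. -/
noncomputable def digitMap (p s : ℕ) [NeZero p] :
    (Fin 2 → Fin p → ZMod p) →ₗ[ZMod p] MvPolynomial (Fin 2) (ZMod p) where
  toFun u := ∑ i, ∑ j ∈ Finset.range (s + 1),
    ((s.choose j : ZMod p) * u i (Fin.ofNat p (digitSum p j))) • (X 0 ^ (s - j) * X 1 ^ j * X i)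
  map_add' u v := by
    simp only [Pi.add_apply, mul_add, add_smul, Finset.sum_add_distrib]
  map_smul' c u := by
    simp only [Pi.smul_apply, smul_eq_mul, mul_left_comm _ c, mul_smul, Finset.smul_sum,
      RingHom.id_apply]

/-- The coordinates of `g · (X^(p-1) ⊗ Y)` in `V_(p-1) ⊗ V_1`, up to binomial coefficients. -/
def orbitVec (p : ℕ) (g : Matrix (Fin 2) (Fin 2) (ZMod p)) : Fin 2 → Fin p → ZMod p :=
  fun i k => g i 1 * (g 0 0 ^ (p - 1 - (k : ℕ)) * g 1 0 ^ (k : ℕ))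

theorem digitMap_orbitVec {p s : ℕ} [Fact p.Prime] (hs : digitSum p s = p - 1)
    (g : Matrix (Fin 2) (Fin 2) (ZMod p)) :
    digitMap p s (orbitVec p g) = matAct p g (X 0 ^ s * X 1) := by
  have hp : 1 < p := (Fact.out : p.Prime).one_lt
  have hco (i : Fin 2) (j : ℕ) :
      (s.choose j : ZMod p) * orbitVec p g i (Fin.ofNat p (digitSum p j)) =
        g i 1 * (s.choose j * (g 0 0 ^ (s - j) * g 1 0 ^ j)) := by
    rw [← choose_mul_pow_eq hs]
    by_cases h : ((s.choose j : ℕ) : ZMod p) = 0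
    · simp [h]
    · have := digitSum_add_of_choose_ne_zero h
      rw [orbitVec, Fin.val_ofNat, Nat.mod_eq_of_lt (by lia)]
      ring
  have hpow : (C (g 0 0) * X 0 + C (g 1 0) * X 1 : MvPolynomial (Fin 2) (ZMod p)) ^ s =
      ∑ j ∈ Finset.range (s + 1),
        C (s.choose j * (g 0 0 ^ (s - j) * g 1 0 ^ j)) * (X 0 ^ (s - j) * X 1 ^ j) := by
    rw [add_comm, add_pow]
    refine Finset.sum_congr rfl fun j _ => ?_
    simp only [map_mul, map_pow, map_natCast]
    ring
  have hrhs : matAct p g (X 0 ^ s * X 1) =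
      (C (g 0 0) * X 0 + C (g 1 0) * X 1) ^ s * ∑ i, C (g i 1) * X i := by
    simp only [matAct, map_mul, map_pow, aeval_X, Fin.sum_univ_two]
  rw [hrhs, hpow, Finset.mul_sum, digitMap, LinearMap.coe_mk, AddHom.coe_mk]
  refine Finset.sum_congr rfl fun i _ => ?_
  rw [Finset.sum_mul]
  refine Finset.sum_congr rfl fun j _ => ?_
  rw [hco, smul_eq_C_mul, C_mul]
  ring

theorem digitMap_injective {p s : ℕ} [Fact p.Prime] (hs : digitSum p s = p - 1) (hps : p ≤ s) :
    Function.Injective (digitMap p s) := by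
  rw [← LinearMap.ker_eq_bot, LinearMap.ker_eq_bot']
  intro u hu
  have hD := congrArg (aeval ![(1 : Polynomial (ZMod p)), Polynomial.X]) hu
  simp only [digitMap, LinearMap.coe_mk, AddHom.coe_mk, Fin.sum_univ_two, map_add, map_sum,
    map_smul, map_mul, map_pow, aeval_X, Matrix.cons_val_zero, Matrix.cons_val_one, one_pow,
    one_mul, mul_one, ← pow_succ, map_zero] at hD
  have hc (i : Fin 2) (n : ℕ) : (if n ∈ Finset.range (s + 1) then
      (s.choose n : ZMod p) * u i (Fin.ofNat p (digitSum p n)) else 0) =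
      (s.choose n : ZMod p) * u i (Fin.ofNat p (digitSum p n)) := by
    split_ifs with hn
    · rfl
    · rw [Nat.choose_eq_zero_of_lt (by simpa using hn)]
      simp
  have hrel (n : ℕ) := congrArg (Polynomial.coeff · (n + 1)) hD
  have hzero := congrArg (Polynomial.coeff · 0) hD
  simp only [Polynomial.coeff_add, Polynomial.finsetSum_coeff, Polynomial.coeff_smul,
    Polynomial.coeff_X_pow, smul_eq_mul, mul_ite, mul_one, mul_zero, Finset.sum_ite_eq,
    add_left_inj, hc, Polynomial.coeff_zero] at hrel hzero
  have key := fun k hk => eq_zero_of_choose_relations (k := k) hs hps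
    (α := fun k => u 0 (Fin.ofNat p k)) (β := fun k => u 1 (Fin.ofNat p k))
    (by simpa [digitSum] using hzero) hrel hk
  ext i k
  have hk : Fin.ofNat p (k : ℕ) = k := by simp
  have := key k k.2
  simp only [hk] at this
  fin_cases i
  · exact this.1
  · exact this.2

theorem span_range_orbitVec (p : ℕ) [Fact p.Prime] :
    Submodule.span (ZMod p) (Set.range (orbitVec p)) = ⊤ := by
  by_contra hne
  obtain ⟨f, hf, hle⟩ := Submodule.exists_le_ker_of_lt_top _ (lt_top_iff_ne_top.2 hne)
  refine hf (LinearMap.pi_ext' fun i => LinearMap.pi_ext' fun k => LinearMap.ext_ring ?_)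
  let Q : Polynomial (ZMod p) :=
    ∑ k : Fin p, Polynomial.monomial (k : ℕ) (f (Pi.single i (Pi.single k 1)))
  have hQ : Q = 0 := by
    have hdeg : Q.natDegree < p := by
      refine lt_of_le_of_lt (Polynomial.natDegree_sum_le_of_forall_le (n := p - 1) _ _ ?_)
        (Nat.sub_lt (Fact.out : p.Prime).pos one_pos)
      exact fun k _ => (Polynomial.natDegree_monomial_le _).trans (by lia)
    refine Polynomial.eq_zero_of_natDegree_lt_card_of_eval_eq_zero Q Function.injective_id
      (fun c => ?_) (by simpa using hdeg)
    have hz : f (Pi.single i fun k : Fin p => c ^ (k : ℕ)) = 0 := by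
      have := hle (Submodule.subset_span
        ⟨Matrix.of ![![1, (Pi.single i 1 : Fin 2 → ZMod p) 0],
          ![c, (Pi.single i 1 : Fin 2 → ZMod p) 1]], rfl⟩)
      rw [LinearMap.mem_ker] at this
      rw [← this]
      congr 1
      ext i' k
      fin_cases i <;> fin_cases i' <;> simp [orbitVec]
    have hv : (Pi.single i fun k : Fin p => c ^ (k : ℕ) : Fin 2 → Fin p → ZMod p) =
        ∑ k : Fin p, c ^ (k : ℕ) • Pi.single i (Pi.single k 1) := by
      ext i' k
      by_cases h : i' = i
      · subst h
        simp [Finset.sum_apply, Pi.single_apply]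
      · simp [Finset.sum_apply, h]
    rw [hv, map_sum] at hz
    simpa [Q, Polynomial.eval_finsetSum, mul_comm] using hz
  have := congrArg (Polynomial.coeff · (k : ℕ)) hQ
  simpa [Q, Polynomial.finsetSum_coeff, Polynomial.coeff_monomial, Fin.val_inj] using this

theorem range_digitMap {p r : ℕ} [Fact p.Prime] (hs : digitSum p (r - 1) = p - 1) :
    LinearMap.range (digitMap p (r - 1)) = Xr1Sub p r := by
  rw [LinearMap.range_eq_map, ← span_range_orbitVec, Submodule.map_span, ← Set.range_comp, Xr1Sub]
  exact congrArg _ (congrArg _ (funext fun g => digitMap_orbitVec hs g))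

theorem matAct_mul (p : ℕ) (g h : Matrix (Fin 2) (Fin 2) (ZMod p))
    (F : MvPolynomial (Fin 2) (ZMod p)) :
    matAct p g (matAct p h F) = matAct p (g * h) F := by
  have : (matAct p g).comp (matAct p h) = matAct p (g * h) := by
    ext1 i
    simp only [matAct, AlgHom.comp_apply, aeval_X, map_mul, algHom_C, algebraMap_eq,
      Fin.sum_univ_two, Matrix.mul_apply, map_add]
    ring
  exact DFunLike.congr_fun this F

theorem Xr1Sub_le_Vh (p : ℕ) {r : ℕ} (hr : 0 < r) : Xr1Sub p r ≤ Vh p r := by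
  have hlin (g : Matrix (Fin 2) (Fin 2) (ZMod p)) (i : Fin 2) :
      (∑ j, C (g j i) * X j : MvPolynomial (Fin 2) (ZMod p)).IsHomogeneous 1 :=
    IsHomogeneous.sum _ _ _ fun j _ => isHomogeneous_C_mul_X _ _
  refine Submodule.span_le.2 ?_
  rintro _ ⟨g, rfl⟩
  have := ((hlin g 0).pow (r - 1)).mul (hlin g 1)
  rw [one_mul, Nat.sub_add_cancel hr] at this
  simpa [matAct, Vh] using this

theorem Vh_le_span (p m : ℕ) : Vh p m ≤ Submodule.span (ZMod p)
    (Set.range fun j : Fin (m + 1) => (X 0 ^ (m - j) * X 1 ^ (j : ℕ) :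
      MvPolynomial (Fin 2) (ZMod p))) := by
  intro F hF
  rw [F.as_sum]
  refine Submodule.sum_mem _ fun d hd => ?_
  have hdeg : d 0 + d 1 = m := by
    have := (mem_homogeneousSubmodule m F).1 hF (mem_support_iff.1 hd)
    simpa [Finsupp.weight_apply, Finsupp.sum_fintype] using this
  rw [monomial_eq, ← smul_eq_C_mul]
  refine Submodule.smul_mem _ _ (Submodule.subset_span ⟨⟨d 1, by lia⟩, ?_⟩)
  simp [Finsupp.prod_fintype, ← hdeg]

theorem digitSum_two_mul_sub_two {p : ℕ} (hp : 2 ≤ p) : digitSum p (2 * p - 2) = p - 1 := by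
  rw [show 2 * p - 2 = (p - 2) + p * 1 by lia, digitSum_add_mul hp (by lia),
    digitSum, Nat.digits_of_lt p 1 one_ne_zero hp]
  simp
  lia

theorem Xr1Sub_eq_Vh (p : ℕ) [Fact p.Prime] : Xr1Sub p (2 * p - 1) = Vh p (2 * p - 1) := by
  have hp : 2 ≤ p := (Fact.out : p.Prime).two_le
  have hs : digitSum p (2 * p - 1 - 1) = p - 1 := digitSum_two_mul_sub_two hp
  have hle := Vh_le_span p (2 * p - 1)
  have hfin : FiniteDimensional (ZMod p) (Submodule.span (ZMod p)
      (Set.range fun j : Fin (2 * p - 1 + 1) => (X 0 ^ (2 * p - 1 - j) * X 1 ^ (j : ℕ) :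
      MvPolynomial (Fin 2) (ZMod p)))) := FiniteDimensional.span_of_finite _ (Set.finite_range _)
  have := Submodule.finiteDimensional_of_le hle
  refine Submodule.eq_of_le_of_finrank_le (Xr1Sub_le_Vh p (by lia)) ?_
  rw [← range_digitMap hs, LinearMap.finrank_range_of_inj (digitMap_injective hs (by lia))]
  refine (Submodule.finrank_mono hle).trans ((finrank_range_le_card _).trans ?_)
  simp [Module.finrank_pi_fintype]
  lia

/-- The action of `g` on the images of the maps `digitMap p s` lifts to coefficient vectors,
independently of `s`. -/
theorem exists_digitMap_eq_matAct {p : ℕ} [Fact p.Prime] (g : Matrix (Fin 2) (Fin 2) (ZMod p))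
    (u : Fin 2 → Fin p → ZMod p) :
    ∃ v, ∀ s, digitSum p s = p - 1 → digitMap p s v = matAct p g (digitMap p s u) := by
  have hu : u ∈ Submodule.span (ZMod p) (Set.range (orbitVec p)) :=
    span_range_orbitVec p ▸ Submodule.mem_top
  induction hu using Submodule.span_induction with
  | mem _ h =>
    obtain ⟨h, rfl⟩ := h
    exact ⟨orbitVec p (g * h), fun s hs => by
      rw [digitMap_orbitVec hs, digitMap_orbitVec hs, matAct_mul]⟩
  | zero => exact ⟨0, by simp⟩
  | add x y _ _ hx hy =>
    obtain ⟨v, hv⟩ := hx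
    obtain ⟨w, hw⟩ := hy
    exact ⟨v + w, fun s hs => by simp only [map_add, hv s hs, hw s hs]⟩
  | smul c x _ hx =>
    obtain ⟨v, hv⟩ := hx
    exact ⟨c • v, fun s hs => by simp only [map_smul, hv s hs]⟩

/-- For a prime `p ≥ 3` and `r > p` with `r ≡ 1 mod (p−1)` and
`Σ_p(r−1) = p − 1`, there is an `M`-equivariant `F_p`-linear isomorphism
`X_{r−1} ≅ V_{2p−1}`. -/
theorem Xr1_iso_V2pm1 (p r : ℕ) (hp : p.Prime) (hp3 : 3 ≤ p) (hr : p < r)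
    (hmod : r ≡ 1 [MOD p - 1]) (hsig : (Nat.digits p (r - 1)).sum = p - 1) :
    ∃ e : ↥(Xr1Sub p r) ≃ₗ[ZMod p] ↥(Vh p (2 * p - 1)),
      EquivMap p 0 0 e.toLinearMap := by
  have : Fact p.Prime := ⟨hp⟩
  have hs₂ : digitSum p (2 * p - 1 - 1) = p - 1 := digitSum_two_mul_sub_two hp.two_le
  have hinj := digitMap_injective hsig (by lia)
  have hinj₂ := digitMap_injective hs₂ (by lia)
  let e₁ := (LinearEquiv.ofInjective _ hinj).trans (LinearEquiv.ofEq _ _ (range_digitMap hsig))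
  let e₂ := (LinearEquiv.ofInjective _ hinj₂).trans
    (LinearEquiv.ofEq _ _ ((range_digitMap hs₂).trans (Xr1Sub_eq_Vh p)))
  have he₁ (u) : (e₁ u : MvPolynomial (Fin 2) (ZMod p)) = digitMap p (r - 1) u := rfl
  have he₂ (u) : (e₂ u : MvPolynomial (Fin 2) (ZMod p)) = digitMap p (2 * p - 1 - 1) u := rfl
  refine ⟨e₁.symm.trans e₂, fun g x y hxy => ?_⟩
  obtain ⟨u, rfl⟩ := e₁.surjective x
  obtain ⟨v, rfl⟩ := e₁.surjective y
  obtain ⟨w, hw⟩ := exists_digitMap_eq_matAct g u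
  simp only [twAct, pow_zero, one_smul, he₁, ← hw _ hsig] at hxy
  obtain rfl := hinj hxy
  simp [twAct, he₂, hw _ hs₂]
end
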